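/- arXiv:2112.11100 — 2 statements merged into one kernel-verified Lean document; each statement's English description precedes it below -/
import Mathlib

section
/- Let A be a 3×3 complex matrix that is not a scalar multiple of the identity, and suppose that Aᴴ ≠ μA + νI for all μ ∈ ℂ∖{0} and ν ∈ ℂ (equivalently, the bidegree (1,1) surface S_A is not j-invariant). Then the set of projective points [q] ∈ ℙ(ℂ³) whose twistor fiber is contained in S_A has at most two elements. -/
open Matrix Complex

noncomputable section

/-- Elements of `ℂ³`. -/
abbrev V3 : Type := Fin 3 → ℂ

/-- The natural pairing `pℓ = p₀ℓ₀ + p₁ℓ₁ + p₂ℓ₂` of a row vector and a column vector. -/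
def pairing (p ℓ : V3) : ℂ := p 0 * ℓ 0 + p 1 * ℓ 1 + p 2 * ℓ 2

/-- The twistor fiber over the nonzero row vector `q` is contained in the surface
`S_A = {(p,ℓ) ∈ F : pAℓ = 0}`. -/
def fiberIn (A : Matrix (Fin 3) (Fin 3) ℂ) (q : V3) : Prop :=
  ∀ p ℓ : V3, p ≠ 0 → ℓ ≠ 0 → pairing p ℓ = 0 → pairing q ℓ = 0 → pairing p (star q) = 0 →
    pairing (Matrix.vecMul p A) ℓ = 0

/-- The set of projective points `[q] ∈ ℙ(ℂ³)` whose twistor fiber is contained in `S_A`. -/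
def twistorSet (A : Matrix (Fin 3) (Fin 3) ℂ) : Set (Projectivization ℂ V3) :=
  {x | ∃ (q : V3) (hq : q ≠ 0), x = Projectivization.mk ℂ q hq ∧ fiberIn A q}

/-- The sesquilinear form attached to `A`. -/
def sesq (A : Matrix (Fin 3) (Fin 3) ℂ) (p r : V3) : ℂ := pairing (Matrix.vecMul p A) (star r)

lemma pairing_swap (p r : V3) : pairing r (star p) = star (pairing p (star r)) := by
  simp [pairing, mul_comm]

lemma pairing_self_ne {p : V3} (hp : p ≠ 0) : pairing p (star p) ≠ 0 := by
  intro h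
  apply hp
  have h2 : p ⬝ᵥ star p = 0 := by
    rw [← h]; simp [pairing, dotProduct, Fin.sum_univ_three]
  open scoped ComplexOrder in
  exact dotProduct_self_star_eq_zero.1 h2

lemma sesq_add_left (A : Matrix (Fin 3) (Fin 3) ℂ) (a b : ℂ) (p p' r : V3) :
    sesq A (a • p + b • p') r = a * sesq A p r + b * sesq A p' r := by
  simp [sesq, pairing, vecMul, dotProduct, Fin.sum_univ_three]; ring

lemma sesq_add_right (A : Matrix (Fin 3) (Fin 3) ℂ) (a b : ℂ) (p r r' : V3) :
    sesq A p (a • r + b • r') = star a * sesq A p r + star b * sesq A p r' := by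
  simp [sesq, pairing, vecMul, dotProduct, Fin.sum_univ_three]; ring

lemma pairing_add_left (a b : ℂ) (p p' r : V3) :
    pairing (a • p + b • p') r = a * pairing p r + b * pairing p' r := by
  simp [pairing]; ring

lemma pairing_add_right (a b : ℂ) (p r r' : V3) :
    pairing p (star (a • r + b • r')) = star a * pairing p (star r) + star b * pairing p (star r') := by
  simp [pairing]; ring

lemma sesq_conjTranspose (A : Matrix (Fin 3) (Fin 3) ℂ) (p r : V3) :
    sesq Aᴴ p r = star (sesq A r p) := by
  simp [sesq, pairing, vecMul, dotProduct, Fin.sum_univ_three]; ring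

lemma sesq_sub_smul (A B : Matrix (Fin 3) (Fin 3) ℂ) (c : ℂ) (p r : V3) :
    sesq (A - c • B) p r = sesq A p r - c * sesq B p r := by
  simp [sesq, pairing, vecMul, dotProduct, Fin.sum_univ_three]; ring

lemma sesq_one (p r : V3) : sesq 1 p r = pairing p (star r) := by
  simp [sesq]

lemma fiber_orth {A : Matrix (Fin 3) (Fin 3) ℂ} {q : V3} (h : fiberIn A q) {p r : V3}
    (hp : pairing p (star q) = 0) (hr : pairing r (star q) = 0) (hpr : pairing p (star r) = 0) :
    sesq A p r = 0 := by
  by_cases p0 : p = 0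
  · subst p0; simp [sesq, pairing]
  by_cases r0 : r = 0
  · subst r0; simp [sesq, pairing]
  refine h p (star r) p0 (by simpa using r0) hpr ?_ hp
  rw [pairing_swap, hr, star_zero]

/-- Value on pairs in terms of the left vector. -/
lemma fiber_left {A : Matrix (Fin 3) (Fin 3) ℂ} {q : V3} (h : fiberIn A q) {p r : V3}
    (hp : pairing p (star q) = 0) (hr : pairing r (star q) = 0) :
    pairing p (star p) * sesq A p r = sesq A p p * pairing p (star r) := by
  have key := fiber_orth h (p := p)
    (r := (pairing p (star p)) • r + (-(pairing r (star p))) • p) hp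
    (by rw [pairing_add_left, hp, hr]; ring)
    (by rw [pairing_add_right, star_neg, ← pairing_swap, ← pairing_swap]; ring)
  rw [sesq_add_right, star_neg, ← pairing_swap, ← pairing_swap] at key
  linear_combination key

lemma fiber_right {A : Matrix (Fin 3) (Fin 3) ℂ} {q : V3} (h : fiberIn A q) {p r : V3}
    (hp : pairing p (star q) = 0) (hr : pairing r (star q) = 0) :
    pairing r (star r) * sesq A p r = sesq A r r * pairing p (star r) := by
  have key := fiber_orth h (r := r)
    (p := (pairing r (star r)) • p + (-(pairing p (star r))) • r)
    (by rw [pairing_add_left, hp, hr]; ring) hr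
    (by rw [pairing_add_left]; ring)
  rw [sesq_add_left] at key
  linear_combination key

lemma fiber_diag {A : Matrix (Fin 3) (Fin 3) ℂ} {q : V3} (h : fiberIn A q) {p r : V3}
    (hp : pairing p (star q) = 0) (hr : pairing r (star q) = 0) :
    pairing p (star p) * sesq A r r = sesq A p p * pairing r (star r) := by
  by_cases hpr : pairing p (star r) = 0
  · have hrp : pairing r (star p) = 0 := by rw [pairing_swap, hpr, star_zero]
    have s1 := fiber_orth h hp hr hpr
    have s2 := fiber_orth h hr hp hrp
    have hs : pairing ((1:ℂ) • p + (1:ℂ) • r) (star q) = 0 := by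
      rw [pairing_add_left, hp, hr]; ring
    have k := fiber_left h hs hp
    have k2 := fiber_left h hs hr
    simp only [sesq_add_left, sesq_add_right, pairing_add_left, pairing_add_right, s1, s2, hpr, hrp,
      star_one] at k k2
    linear_combination k2
  · have k := fiber_left h hp hr
    have k2 := fiber_right h hp hr
    have : pairing p (star r) * (pairing p (star p) * sesq A r r - sesq A p p * pairing r (star r)) = 0 := by
      linear_combination pairing r (star r) * k - pairing p (star p) * k2
    rcases mul_eq_zero.1 this with h' | h'
    · exact absurd h' hpr
    · linear_combination h'

lemma fiber_all {A : Matrix (Fin 3) (Fin 3) ℂ} {q x : V3} (h : fiberIn A q) (x0 : x ≠ 0)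
    (hx : pairing x (star q) = 0) {c : ℂ} (hc : sesq A x x = c * pairing x (star x)) {p r : V3}
    (hp : pairing p (star q) = 0) (hr : pairing r (star q) = 0) :
    sesq (A - c • 1) p r = 0 := by
  rw [sesq_sub_smul, sesq_one]
  by_cases p0 : p = 0
  · subst p0; simp [sesq, pairing]
  have hxx := pairing_self_ne x0
  have hpp := pairing_self_ne p0
  have k := fiber_left h hp hr
  have d := fiber_diag h hx hp
  apply mul_left_cancel₀ hxx
  apply mul_left_cancel₀ hpp
  rw [hc] at d
  linear_combination pairing x (star x) * k + pairing p (star r) * d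

lemma eq_zero_of_gram {E M : Matrix (Fin 3) (Fin 3) ℂ} (hE : E.det ≠ 0)
    (h : ∀ i j, sesq M (E i) (E j) = 0) : M = 0 := by
  have h1 : E * M * Eᴴ = 0 := by
    ext i j
    rw [Matrix.zero_apply, ← h i j]
    simp [sesq, pairing, vecMul, dotProduct, Matrix.mul_apply, Fin.sum_univ_three]
  have u : IsUnit E.det := isUnit_iff_ne_zero.2 hE
  have u' : IsUnit Eᴴ.det := by
    rw [Matrix.det_conjTranspose]; exact u.star
  have h2 : E * M = 0 := by
    have := congrArg (· * (Eᴴ)⁻¹) h1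
    simpa [Matrix.mul_nonsing_inv_cancel_right _ _ u'] using this
  have := congrArg (E⁻¹ * ·) h2
  simpa [Matrix.nonsing_inv_mul_cancel_left _ _ u] using this

lemma eq_zero_of_gram3 {x y z : V3} {M : Matrix (Fin 3) (Fin 3) ℂ}
    (hE : (Matrix.of ![x, y, z]).det ≠ 0)
    (h00 : sesq M x x = 0) (h01 : sesq M x y = 0) (h02 : sesq M x z = 0)
    (h10 : sesq M y x = 0) (h11 : sesq M y y = 0) (h12 : sesq M y z = 0)
    (h20 : sesq M z x = 0) (h21 : sesq M z y = 0) (h22 : sesq M z z = 0) : M = 0 := by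
  apply eq_zero_of_gram hE
  intro i j
  fin_cases i <;> fin_cases j <;> assumption

/-- Cross product, conjugated. -/
def cc (a b : V3) : V3 :=
  ![star (a 1 * b 2 - a 2 * b 1), star (a 2 * b 0 - a 0 * b 2), star (a 0 * b 1 - a 1 * b 0)]

lemma cc_left (a b : V3) : pairing (cc a b) (star a) = 0 := by
  simp [cc, pairing]; ring

lemma cc_right (a b : V3) : pairing (cc a b) (star b) = 0 := by
  simp [cc, pairing]; ring

lemma cc_ne {a b : V3} (ha : a ≠ 0) (hb : b ≠ 0)
    (h : Projectivization.mk ℂ a ha ≠ Projectivization.mk ℂ b hb) : cc a b ≠ 0 := by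
  intro h0
  apply h
  rw [Projectivization.mk_eq_mk_iff']
  have e0 : a 1 * b 2 - a 2 * b 1 = 0 := by
    have := congrFun h0 0
    simp only [cc, Matrix.cons_val, Pi.zero_apply, star_eq_zero] at this; exact this
  have e1 : a 2 * b 0 - a 0 * b 2 = 0 := by
    have := congrFun h0 1
    simp only [cc, Matrix.cons_val, Pi.zero_apply, star_eq_zero] at this; exact this
  have e2 : a 0 * b 1 - a 1 * b 0 = 0 := by
    have := congrFun h0 2
    simp only [cc, Matrix.cons_val, Pi.zero_apply, star_eq_zero] at this; exact this
  have hbb := pairing_self_ne hb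
  refine ⟨pairing a (star b) / pairing b (star b), ?_⟩
  ext i
  simp only [Pi.smul_apply, smul_eq_mul]
  rw [div_mul_eq_mul_div, div_eq_iff hbb]
  simp only [pairing, Pi.star_apply]
  fin_cases i <;> simp
  · linear_combination (-(starRingEnd ℂ) (b 1)) * e2 + (starRingEnd ℂ) (b 2) * e1
  · linear_combination ((starRingEnd ℂ) (b 0)) * e2 - (starRingEnd ℂ) (b 2) * e0
  · linear_combination (-(starRingEnd ℂ) (b 0)) * e1 + (starRingEnd ℂ) (b 1) * e0

lemma cc_add (α β : ℂ) (a b n : V3) :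
    cc (α • a + β • b) n = star α • cc a n + star β • cc b n := by
  ext i; fin_cases i <;> simp [cc] <;> ring

lemma span_of_det (a b d : V3) (hn : cc a b ≠ 0) (hd : pairing (star (cc a b)) d = 0) :
    ∃ α β : ℂ, d = α • a + β • b := by
  have hN := pairing_self_ne hn
  refine ⟨pairing (star (cc b (cc a b))) d / pairing (cc a b) (star (cc a b)),
    - pairing (star (cc a (cc a b))) d / pairing (cc a b) (star (cc a b)), ?_⟩
  ext i
  simp only [Pi.add_apply, Pi.smul_apply, smul_eq_mul]
  field_simp
  simp only [pairing, Pi.star_apply, cc, Matrix.cons_val, star_star] at hd ⊢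
  fin_cases i <;> simp at hd ⊢
  · linear_combination ((starRingEnd ℂ) (a 1) * (starRingEnd ℂ) (b 2) - (starRingEnd ℂ) (a 2) * (starRingEnd ℂ) (b 1)) * hd
  · linear_combination ((starRingEnd ℂ) (a 2) * (starRingEnd ℂ) (b 0) - (starRingEnd ℂ) (a 0) * (starRingEnd ℂ) (b 2)) * hd
  · linear_combination ((starRingEnd ℂ) (a 0) * (starRingEnd ℂ) (b 1) - (starRingEnd ℂ) (a 1) * (starRingEnd ℂ) (b 0)) * hd

lemma pairing_star_comm (p : V3) : pairing (star p) p = pairing p (star p) := by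
  simp [pairing, mul_comm]

lemma det_indep (a b d : V3) :
    (Matrix.of ![cc b d, cc d a, cc a b]).det = star (pairing (star (cc a b)) d) ^ 2 := by
  simp [Matrix.det_fin_three, cc, pairing]; ring

lemma det_dep (a b n : V3) :
    (Matrix.of ![cc b n, cc a n, n]).det
      = - (star (pairing (star (cc a b)) n) * star (pairing n (star n))) := by
  simp [Matrix.det_fin_three, cc, pairing]; ring

theorem stmt_14 (A : Matrix (Fin 3) (Fin 3) ℂ)
    (hA : ∀ c : ℂ, A ≠ c • (1 : Matrix (Fin 3) (Fin 3) ℂ))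
    (hreal : ∀ μ ν : ℂ, μ ≠ 0 → Aᴴ ≠ μ • A + ν • 1) :
    (twistorSet A).encard ≤ 2 := by
  by_contra hcon
  rw [not_le] at hcon
  have h3 : (3 : ℕ∞) ≤ (twistorSet A).encard := by
    have := Order.add_one_le_of_lt hcon
    norm_num at this
    exact this
  obtain ⟨t, ht, ht3⟩ := Set.exists_subset_encard_eq h3
  obtain ⟨x1, x2, x3, h12, h13, h23, rfl⟩ := Set.encard_eq_three.1 ht3
  obtain ⟨a, ha, rfl, fa⟩ := ht (show x1 ∈ _ by simp)
  obtain ⟨b, hb, rfl, fb⟩ := ht (show x2 ∈ _ by simp)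
  obtain ⟨d, hd, rfl, fd⟩ := ht (show x3 ∈ _ by simp)
  have n12 := cc_ne ha hb h12
  have n13 := cc_ne ha hd h13
  have n23 := cc_ne hb hd h23
  obtain ⟨c, hc⟩ : ∃ c : ℂ, sesq A (cc a b) (cc a b) = c * pairing (cc a b) (star (cc a b)) :=
    ⟨_, (div_mul_cancel₀ _ (pairing_self_ne n12)).symm⟩
  have Fa : ∀ {p r : V3}, pairing p (star a) = 0 → pairing r (star a) = 0 →
      sesq (A - c • 1) p r = 0 := fun hp hr => fiber_all fa n12 (cc_left _ _) hc hp hr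
  have Fb : ∀ {p r : V3}, pairing p (star b) = 0 → pairing r (star b) = 0 →
      sesq (A - c • 1) p r = 0 := fun hp hr => fiber_all fb n12 (cc_right _ _) hc hp hr
  have hc' : sesq A (cc a d) (cc a d) = c * pairing (cc a d) (star (cc a d)) := by
    have := Fa (cc_left a d) (cc_left a d)
    rw [sesq_sub_smul, sesq_one] at this
    linear_combination this
  have Fd : ∀ {p r : V3}, pairing p (star d) = 0 → pairing r (star d) = 0 →
      sesq (A - c • 1) p r = 0 := fun hp hr => fiber_all fd n13 (cc_right _ _) hc' hp hr
  have hA' : A - c • 1 ≠ 0 := fun h => hA c (sub_eq_zero.1 h)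
  have hR' : ∀ μ : ℂ, μ ≠ 0 → (A - c • 1)ᴴ - μ • (A - c • 1) ≠ 0 := by
    intro μ hμ h
    apply hreal μ (star c - μ * c) hμ
    rw [Matrix.conjTranspose_sub, Matrix.conjTranspose_smul, Matrix.conjTranspose_one] at h
    rw [sub_smul, ← smul_smul]
    rw [smul_sub] at h
    rw [← sub_eq_zero, ← h]
    abel
  generalize A - c • 1 = B at *
  by_cases hdet : pairing (star (cc a b)) d = 0
  · obtain ⟨α, β, hαβ⟩ := span_of_det a b d n12 hdet
    have hα : α ≠ 0 := by
      rintro rfl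
      apply n23
      rw [hαβ]
      ext i; fin_cases i <;> simp [cc] <;> ring
    have hβ : β ≠ 0 := by
      rintro rfl
      apply n13
      rw [hαβ]
      ext i; fin_cases i <;> simp [cc] <;> ring
    set n := cc a b with hn
    have na : pairing n (star a) = 0 := cc_left _ _
    have nb : pairing n (star b) = 0 := cc_right _ _
    set E : Matrix (Fin 3) (Fin 3) ℂ := Matrix.of ![cc b n, cc a n, n] with hE
    have hEdet : E.det ≠ 0 := by
      rw [hE, det_dep, ← hn, pairing_star_comm]
      simpa using pairing_self_ne n12
    have b11 := Fb (cc_left b n) (cc_left b n)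
    have b13 := Fb (cc_left b n) nb
    have b31 := Fb nb (cc_left b n)
    have b22 := Fa (cc_left a n) (cc_left a n)
    have b23 := Fa (cc_left a n) na
    have b32 := Fa na (cc_left a n)
    have b33 := Fa na na
    have w := Fd (cc_left d n) (cc_left d n)
    rw [hαβ, cc_add, sesq_add_left, sesq_add_right, sesq_add_right, b11, b22] at w
    simp only [star_star] at w
    have w' : star α * β * sesq B (cc a n) (cc b n) + star β * α * sesq B (cc b n) (cc a n) = 0 := by
      linear_combination w
    have hsα : star α ≠ 0 := star_ne_zero.2 hα
    have hsβ : star β ≠ 0 := star_ne_zero.2 hβ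
    set s := sesq B (cc b n) (cc a n) with hs
    set t := sesq B (cc a n) (cc b n) with ht
    have s0 : s ≠ 0 := by
      intro s0
      have t0 : t = 0 := by
        rw [s0] at w'
        simpa [hα, hβ] using w'
      apply hA'
      exact eq_zero_of_gram3 hEdet b11 s0 b13 t0 b22 b23 b31 b32 b33
    have t0 : t ≠ 0 := by
      intro t0
      rw [t0] at w'
      apply s0
      simpa [hα, hβ] using w'
    have w2 : α * star β * star t + β * star α * star s = 0 := by
      have := congrArg star w'
      simp only [star_add, star_mul', star_star, star_zero] at this
      exact this
    have st : star s = star t / s * t := by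
      field_simp
      apply mul_left_cancel₀ hsα
      apply mul_left_cancel₀ hβ
      linear_combination s * w2 - star t * w'
    apply hR' (star t / s) (div_ne_zero (star_ne_zero.2 t0) s0)
    apply eq_zero_of_gram3 hEdet <;> rw [sesq_sub_smul, sesq_conjTranspose] <;>
      simp only [b11, b13, b31, b22, b23, b32, b33, ← hs, ← ht, star_zero, mul_zero, sub_zero]
    · field_simp; ring
    · rw [st]; ring
  · apply hA'
    apply eq_zero_of_gram (E := Matrix.of ![cc b d, cc d a, cc a b])
    · rw [det_indep]
      exact pow_ne_zero _ (star_ne_zero.2 hdet)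
    · intro i j
      fin_cases i <;> fin_cases j
      · exact Fb (cc_left _ _) (cc_left _ _)
      · exact Fd (cc_right _ _) (cc_left _ _)
      · exact Fb (cc_left _ _) (cc_right _ _)
      · exact Fd (cc_left _ _) (cc_right _ _)
      · exact Fd (cc_left _ _) (cc_left _ _)
      · exact Fa (cc_right _ _) (cc_left _ _)
      · exact Fb (cc_right _ _) (cc_left _ _)
      · exact Fa (cc_left _ _) (cc_right _ _)
      · exact Fa (cc_left _ _) (cc_left _ _)
end
end

section
/- Let a, b ≥ 1 be integers and let P ∈ ℂ[p₀,p₁,p₂,ℓ₀,ℓ₁,ℓ₂] be bihomogeneous of bidegree (a,b) (homogeneous of degree a in p₀,p₁,p₂ and of degree b in ℓ₀,ℓ₁,ℓ₂), such that the image of P in the quotient ring ℂ[p₀,p₁,p₂,ℓ₀,ℓ₁,ℓ₂]/(p₀ℓ₀+p₁ℓ₁+p₂ℓ₂) is a nonzero prime element, so that the zero locus S = {(p,ℓ) ∈ F : P(p,ℓ) = 0} is an integral surface of bidegree (a,b) in the flag manifold F. If S ≠ j(S) as subsets of F, then the set of projective points [q] ∈ ℙ(ℂ³) whose twistor fiber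 is contained in S has at most a² + ab + b² − 1 elements. -/
open Matrix Complex

noncomputable section

/-- Polynomials in the six variables `p₀,p₁,p₂` (indexed by `Sum.inl`) and `ℓ₀,ℓ₁,ℓ₂`
(indexed by `Sum.inr`). -/
abbrev PRing : Type := MvPolynomial (Fin 3 ⊕ Fin 3) ℂ

/-- The weight assigning bidegree `(1,0)` to the `p`-variables and `(0,1)` to the
`ℓ`-variables, so that `IsWeightedHomogeneous wt P (a,b)` means `P` is bihomogeneous of
bidegree `(a,b)`. -/
def wt : (Fin 3 ⊕ Fin 3) → ℕ × ℕ := Sum.elim (fun _ => (1, 0)) (fun _ => (0, 1))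

/-- The polynomial `p₀ℓ₀ + p₁ℓ₁ + p₂ℓ₂` cutting out the flag manifold. -/
def flagPoly : PRing := ∑ i : Fin 3, MvPolynomial.X (Sum.inl i) * MvPolynomial.X (Sum.inr i)

/-- Evaluation of a polynomial at `(p,ℓ)`. -/
def evalP (P : PRing) (p ℓ : V3) : ℂ := MvPolynomial.eval (Sum.elim p ℓ) P

/-- The zero locus `S = {(p,ℓ) ∈ F : P(p,ℓ) = 0}` inside the flag manifold. -/
def SZero (P : PRing) : Set (V3 × V3) :=
  {x | x.1 ≠ 0 ∧ x.2 ≠ 0 ∧ pairing x.1 x.2 = 0 ∧ evalP P x.1 x.2 = 0}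

/-- The anti-holomorphic involution `j(p,ℓ) = (ℓ*, p*)` of the flag manifold. -/
def jmap : V3 × V3 → V3 × V3 := fun x => (star x.2, star x.1)

/-- The twistor fiber over a nonzero row vector `q`. -/
def twFiber (q : V3) : Set (V3 × V3) :=
  {x | x.1 ≠ 0 ∧ x.2 ≠ 0 ∧ pairing x.1 x.2 = 0 ∧ pairing q x.2 = 0 ∧
    pairing x.1 (star q) = 0}


open MvPolynomial in
/-- The space of bihomogeneous polynomials of bidegree `(m,n)`. -/
def Abi (m n : ℕ) : Submodule ℂ PRing := weightedHomogeneousSubmodule ℂ wt (m, n)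

lemma weight_wt (d : (Fin 3 ⊕ Fin 3) →₀ ℕ) :
    Finsupp.weight wt d = (∑ i, d (Sum.inl i), ∑ i, d (Sum.inr i)) := by
  rw [Finsupp.weight_apply, Finsupp.sum_fintype _ _ (by simp)]
  ext <;> simp [Fintype.sum_sum_type, wt, Fin.sum_univ_three]

def antiEquiv (m n : ℕ) : {d : (Fin 3 ⊕ Fin 3) →₀ ℕ | Finsupp.weight wt d = (m, n)} ≃
    (Finset.univ : Finset (Fin 3)).finsuppAntidiag m ×
    (Finset.univ : Finset (Fin 3)).finsuppAntidiag n where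
  toFun d := (⟨(Finsupp.sumFinsuppEquivProdFinsupp d.1).1, by
      have := d.2
      simp only [Set.mem_ofPred_eq, weight_wt, Prod.mk.injEq] at this
      exact Finset.mem_finsuppAntidiag.2 ⟨this.1, by simp⟩⟩,
    ⟨(Finsupp.sumFinsuppEquivProdFinsupp d.1).2, by
      have := d.2
      simp only [Set.mem_ofPred_eq, weight_wt, Prod.mk.injEq] at this
      exact Finset.mem_finsuppAntidiag.2 ⟨this.2, by simp⟩⟩)
  invFun x := ⟨Finsupp.sumFinsuppEquivProdFinsupp.symm (x.1.1, x.2.1), by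
      have h1 := x.1.2
      have h2 := x.2.2
      simp only [Finset.mem_finsuppAntidiag] at h1 h2
      simp only [Set.mem_ofPred_eq, weight_wt, Prod.mk.injEq]
      simp [h1.1, h2.1]⟩
  left_inv d := by simp
  right_inv x := by simp

lemma finite_anti (m n : ℕ) :
    Finite {d : (Fin 3 ⊕ Fin 3) →₀ ℕ | Finsupp.weight wt d = (m, n)} :=
  Finite.of_equiv _ (antiEquiv m n).symm

instance (m n : ℕ) : FiniteDimensional ℂ (Abi m n) := by
  have := finite_anti m n
  unfold Abi
  rw [MvPolynomial.weightedHomogeneousSubmodule_eq_finsupp_supported]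
  exact Module.Finite.of_basis (MvPolynomial.basisRestrictSupport ℂ _)

lemma choose_two (n : ℕ) : ((3 + n - 1).choose n : ℚ) = (n + 1) * (n + 2) / 2 := by
  have : (3 + n - 1) = n + 2 := by omega
  rw [this, Nat.choose_symm_add, Nat.cast_choose_two]
  push_cast
  ring

lemma finrank_Abi (m n : ℕ) :
    (Module.finrank ℂ (Abi m n) : ℚ) = (m + 1) * (m + 2) / 2 * ((n + 1) * (n + 2) / 2) := by
  have := finite_anti m n
  unfold Abi
  rw [MvPolynomial.weightedHomogeneousSubmodule_eq_finsupp_supported]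
  change ((Module.finrank ℂ (MvPolynomial.restrictSupport ℂ
    {d : (Fin 3 ⊕ Fin 3) →₀ ℕ | Finsupp.weight wt d = (m, n)}) : ℕ) : ℚ) = _
  rw [Module.finrank_eq_nat_card_basis (MvPolynomial.basisRestrictSupport ℂ _),
    Nat.card_congr (antiEquiv m n), Nat.card_prod]
  simp only [Nat.card_eq_fintype_card, Fintype.card_coe,
    Finset.card_finsuppAntidiag_nat_eq_choose]
  push_cast
  simp only [Finset.card_univ, Fintype.card_fin, choose_two]

lemma flag_irred : Irreducible flagPoly := by
  have h := MvPolynomial.irreducible_sumSMulXSMulY (R := ℂ) (n := Fin 3)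
    (Finsupp.equivFunOnFinite.symm (fun _ => 1)) ?_ ?_
  · convert h
    simp [flagPoly, MvPolynomial.sumSMulXSMulY, Finsupp.linearCombination_apply,
      Finsupp.sum_fintype]
  · refine ⟨0, by simp, 1, by simp, by simp⟩
  · intro r hr
    have := hr 0
    simpa [isUnit_iff_dvd_one] using this

abbrev RR : Type := PRing ⧸ Ideal.span {flagPoly}

abbrev mkR : PRing →ₐ[ℂ] RR := Ideal.Quotient.mkₐ ℂ (Ideal.span {flagPoly})

lemma flag_prime : Prime flagPoly := flag_irred.prime

instance : IsDomain RR := by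
  have : (Ideal.span {flagPoly}).IsPrime :=
    (Ideal.span_singleton_prime flag_prime.ne_zero).2 flag_prime
  exact Ideal.Quotient.isDomain _

lemma mkR_eq_zero {x : PRing} : mkR x = 0 ↔ flagPoly ∣ x := by
  simp [Ideal.Quotient.eq_zero_iff_mem, Ideal.mem_span_singleton]

lemma flag_mem : flagPoly ∈ Abi 1 1 := by
  unfold Abi flagPoly
  refine Submodule.sum_mem _ fun i _ => ?_
  rw [MvPolynomial.mem_weightedHomogeneousSubmodule]
  exact (MvPolynomial.isWeightedHomogeneous_X ℂ wt (Sum.inl i)).mul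
    (MvPolynomial.isWeightedHomogeneous_X ℂ wt (Sum.inr i))

lemma Abi_mul {m n m' n' : ℕ} {x y : PRing} (hx : x ∈ Abi m n) (hy : y ∈ Abi m' n') :
    x * y ∈ Abi (m + m') (n + n') :=
  MvPolynomial.IsWeightedHomogeneous.mul hx hy

/-- The bihomogeneous component. -/
def bicomp (m n : ℕ) : PRing →ₗ[ℂ] PRing := MvPolynomial.weightedHomogeneousComponent wt (m, n)

lemma bicomp_mem (m n : ℕ) (x : PRing) : bicomp m n x ∈ Abi m n :=
  MvPolynomial.weightedHomogeneousComponent_mem _ _ _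

lemma bicomp_self {m n : ℕ} {x : PRing} (hx : x ∈ Abi m n) : bicomp m n x = x :=
  MvPolynomial.IsWeightedHomogeneous.weightedHomogeneousComponent_same hx

lemma bicomp_mul {m n m' n' : ℕ} {x y : PRing} (hx : x ∈ Abi m n) :
    bicomp (m + m') (n + n') (x * y) = x * bicomp m' n' y := by
  letI := MvPolynomial.weightedGradedAlgebra ℂ wt
  have := DirectSum.coe_decompose_mul_add_of_left_mem
    (MvPolynomial.weightedHomogeneousSubmodule ℂ wt) (i := (m, n)) (j := (m', n')) (b := y) hx
  rw [Prod.mk_add_mk] at this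
  have key : ∀ (z : PRing) (i : ℕ × ℕ),
      (DirectSum.decompose (MvPolynomial.weightedHomogeneousSubmodule ℂ wt) z i : PRing)
        = MvPolynomial.weightedHomogeneousComponent wt i z := fun z i =>
    MvPolynomial.decompose'_apply ℂ wt z i
  rw [key, key] at this
  exact this

/-- The bigraded pieces of the coordinate ring of the flag manifold. -/
def Rbi (m n : ℕ) : Submodule ℂ RR := (Abi m n).map mkR.toLinearMap

instance (m n : ℕ) : FiniteDimensional ℂ (Rbi m n) := by
  unfold Rbi; infer_instance

lemma mem_Rbi {m n : ℕ} {x : RR} : x ∈ Rbi m n ↔ ∃ y ∈ Abi m n, mkR y = x := by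
  simp [Rbi, Submodule.mem_map]

section LA
variable {V W : Type*} [AddCommGroup V] [Module ℂ V] [AddCommGroup W] [Module ℂ W]

lemma finrank_map_ker (f : V →ₗ[ℂ] W) (S : Submodule ℂ V) [FiniteDimensional ℂ S] :
    Module.finrank ℂ (S.map f) + Module.finrank ℂ (S ⊓ LinearMap.ker f : Submodule ℂ V)
      = Module.finrank ℂ S := by
  have h := LinearMap.finrank_range_add_finrank_ker (f.domRestrict S)
  rw [LinearMap.range_domRestrict] at h
  rw [← h, LinearMap.ker_domRestrict, ← Submodule.finrank_map_subtype_eq, Submodule.map_comap_subtype]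

lemma finrank_map_inj (f : V →ₗ[ℂ] W) (hf : Function.Injective f) (S : Submodule ℂ V) :
    Module.finrank ℂ (S.map f) = Module.finrank ℂ S :=
  (Submodule.equivMapOfInjective f hf S).finrank_eq.symm
end LA

lemma finrank_Rbi (m n : ℕ) (hm : 1 ≤ m) (hn : 1 ≤ n) :
    (Module.finrank ℂ (Rbi m n) : ℚ) = (m + 1) * (n + 1) * (m + n + 2) / 2 := by
  obtain ⟨m, rfl⟩ := Nat.exists_eq_add_of_le hm
  obtain ⟨n, rfl⟩ := Nat.exists_eq_add_of_le hn
  have h := finrank_map_ker mkR.toLinearMap (Abi (1 + m) (1 + n))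
  have h2 : Abi (1 + m) (1 + n) ⊓ LinearMap.ker mkR.toLinearMap
      = (Abi m n).map (LinearMap.mulLeft ℂ flagPoly) := by
    ext x
    simp only [Submodule.mem_inf, LinearMap.mem_ker, AlgHom.toLinearMap_apply, mkR_eq_zero,
      Submodule.mem_map, LinearMap.mulLeft_apply]
    constructor
    · rintro ⟨hx, y, rfl⟩
      refine ⟨bicomp m n y, bicomp_mem _ _ _, ?_⟩
      rw [← bicomp_mul flag_mem, bicomp_self hx]
    · rintro ⟨y, hy, rfl⟩
      exact ⟨Abi_mul flag_mem hy, dvd_mul_right _ _⟩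
  rw [h2, finrank_map_inj (LinearMap.mulLeft ℂ flagPoly) (by
    intro x y hxy
    exact mul_left_cancel₀ flag_prime.ne_zero hxy)] at h
  change Module.finrank ℂ (Rbi (1 + m) (1 + n)) + _ = _ at h
  have h' : (Module.finrank ℂ (Rbi (1 + m) (1 + n)) : ℚ) + Module.finrank ℂ (Abi m n)
    = Module.finrank ℂ (Abi (1 + m) (1 + n)) := by exact_mod_cast h
  rw [finrank_Abi, finrank_Abi] at h'
  push_cast at h' ⊢
  linear_combination h'

/-- Koszul-type estimate. -/
lemma finrank_ideal {a b K : ℕ} (hK : 1 ≤ K) {P Q : PRing} (hP : P ∈ Abi a b) (hQ : Q ∈ Abi b a)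
    (hp : Prime (mkR P)) (hPQ : ¬ mkR P ∣ mkR Q) :
    ∃ I : Submodule ℂ RR, I ≤ Rbi (a + b + K) (a + b + K) ∧
      (∀ x ∈ I, ∃ u v, x = mkR P * u + mkR Q * v) ∧
      Module.finrank ℂ (Rbi (b + K) (a + K)) + Module.finrank ℂ (Rbi (a + K) (b + K)) ≤
        Module.finrank ℂ I + Module.finrank ℂ (Rbi K K) := by
  set U := (Rbi (b + K) (a + K)).map (LinearMap.mulLeft ℂ (mkR P)) with hU
  set V := (Rbi (a + K) (b + K)).map (LinearMap.mulLeft ℂ (mkR Q)) with hV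
  have hQ0 : mkR Q ≠ 0 := by
    intro h; rw [h] at hPQ; exact hPQ (dvd_zero _)
  have hUf : Module.finrank ℂ U = Module.finrank ℂ (Rbi (b + K) (a + K)) :=
    finrank_map_inj _ (fun x y h => mul_left_cancel₀ hp.ne_zero h) _
  have hVf : Module.finrank ℂ V = Module.finrank ℂ (Rbi (a + K) (b + K)) :=
    finrank_map_inj _ (fun x y h => mul_left_cancel₀ hQ0 h) _
  refine ⟨U ⊔ V, ?_, ?_, ?_⟩
  · refine sup_le ?_ ?_
    · rintro _ ⟨_, ⟨y, hy, rfl⟩, rfl⟩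
      refine mem_Rbi.2 ⟨P * y, ?_, by simp⟩
      rw [add_assoc, show a + (b + K) = b + (a + K) by ring]
      have := Abi_mul hP hy
      rw [show b + (a + K) = a + (b + K) by ring] at *
      exact this
    · rintro _ ⟨_, ⟨y, hy, rfl⟩, rfl⟩
      refine mem_Rbi.2 ⟨Q * y, ?_, by simp⟩
      have := Abi_mul hQ hy
      rw [← add_assoc, ← add_assoc, add_comm b a] at this
      exact this
  · intro x hx
    obtain ⟨u, ⟨u', -, rfl⟩, v, ⟨v', -, rfl⟩, rfl⟩ := Submodule.mem_sup.1 hx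
    exact ⟨u', v', rfl⟩
  · have h := Submodule.finrank_sup_add_finrank_inf_eq U V
    have h3 : U ⊓ V ≤ (Rbi K K).map (LinearMap.mulLeft ℂ (mkR Q * mkR P)) := by
      rintro x ⟨⟨u, -, hu⟩, ⟨v, hv, hv'⟩⟩
      simp only [LinearMap.mulLeft_apply] at hu hv'
      have hd : mkR P ∣ mkR Q * v := ⟨u, by rw [hv', hu]⟩
      obtain ⟨w, hw⟩ := (hp.dvd_or_dvd hd).resolve_left hPQ
      obtain ⟨v₀, hv₀, rfl⟩ := mem_Rbi.1 hv
      obtain ⟨w₀, rfl⟩ := Ideal.Quotient.mk_surjective w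
      have hz : mkR (v₀ - P * w₀) = 0 := by
        rw [map_sub, map_mul, hw]; simp
      obtain ⟨z, hz⟩ := mkR_eq_zero.1 hz
      have e : v₀ = P * bicomp K K w₀ + bicomp (a + K) (b + K) (flagPoly * z) := by
        rw [← bicomp_mul hP, ← map_add, ← hz, add_sub_cancel, bicomp_self hv₀]
      obtain ⟨A, hA⟩ := Nat.exists_eq_add_of_le (show 1 ≤ a + K by omega)
      obtain ⟨B, hB⟩ := Nat.exists_eq_add_of_le (show 1 ≤ b + K by omega)
      rw [hA, hB, bicomp_mul flag_mem] at e
      refine ⟨mkR (bicomp K K w₀), mem_Rbi.2 ⟨_, bicomp_mem _ _ _, rfl⟩, ?_⟩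
      have e2 : mkR v₀ = mkR P * mkR (bicomp K K w₀) := by
        rw [e, map_add, map_mul, map_mul, mkR_eq_zero.2 (dvd_refl _), zero_mul, add_zero]
      rw [LinearMap.mulLeft_apply, ← hv', e2, mul_assoc]
    have h4 := Submodule.finrank_mono h3
    rw [finrank_map_inj _ (fun x y h => mul_left_cancel₀ (mul_ne_zero hQ0 hp.ne_zero) h)] at h4
    omega

/-- Cross product. -/
def cr (u v : V3) : V3 :=
  ![u 1 * v 2 - u 2 * v 1, u 2 * v 0 - u 0 * v 2, u 0 * v 1 - u 1 * v 0]

@[simp] lemma cr_0 (u v : V3) : cr u v 0 = u 1 * v 2 - u 2 * v 1 := rfl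
@[simp] lemma cr_1 (u v : V3) : cr u v 1 = u 2 * v 0 - u 0 * v 2 := rfl
@[simp] lemma cr_2 (u v : V3) : cr u v 2 = u 0 * v 1 - u 1 * v 0 := rfl

lemma ext3 {u v : V3} (h0 : u 0 = v 0) (h1 : u 1 = v 1) (h2 : u 2 = v 2) : u = v := by
  funext i
  fin_cases i <;> assumption

lemma pairing_star_ne {x : V3} (hx : x ≠ 0) : pairing x (star x) ≠ 0 := by
  intro h
  apply hx
  have h' : (((normSq (x 0) + normSq (x 1) + normSq (x 2) : ℝ)) : ℂ) = 0 := by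
    push_cast
    rw [← h]
    simp [pairing, mul_conj]
  have h'' : normSq (x 0) + normSq (x 1) + normSq (x 2) = 0 := by exact_mod_cast h'
  have n0 := normSq_nonneg (x 0)
  have n1 := normSq_nonneg (x 1)
  have n2 := normSq_nonneg (x 2)
  refine ext3 ?_ ?_ ?_ <;> refine normSq_eq_zero.1 ?_ <;> linarith

lemma star_cr (u v : V3) : star (cr u v) = cr (star u) (star v) := by
  refine ext3 ?_ ?_ ?_ <;> simp

lemma exists_cr {w : V3} (hw : w ≠ 0) : ∃ e f, cr e f = w := by
  by_cases h0 : w 0 = 0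
  · by_cases h1 : w 1 = 0
    · by_cases h2 : w 2 = 0
      · exact absurd (ext3 h0 h1 h2) hw
      · refine ⟨![1, 0, - w 0 / w 2], ![0, w 2, - w 1], ?_⟩
        refine ext3 ?_ ?_ ?_ <;> simp [h2]
    · refine ⟨![0, - w 2 / w 1, 1], ![w 1, - w 0, 0], ?_⟩
      refine ext3 ?_ ?_ ?_ <;> simp [h1]
  · refine ⟨![- w 1 / w 0, 1, 0], ![- w 2, 0, w 0], ?_⟩
    refine ext3 ?_ ?_ ?_ <;> simp [h0]

lemma exists_minor {e f : V3} (h : cr e f ≠ 0) :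
    ∃ v w, pairing e v * pairing f w - pairing f v * pairing e w ≠ 0 := by
  obtain ⟨v, w, hvw⟩ := exists_cr (star_ne_zero.2 h)
  refine ⟨v, w, ?_⟩
  have := pairing_star_ne h
  rw [← hvw] at this
  convert this using 1
  simp only [pairing, cr_0, cr_1, cr_2]
  ring

lemma cr_cr_ne {q e f : V3} (hq : q ≠ 0) (h : cr e f = star q) :
    cr (cr q e) (cr q f) ≠ 0 := by
  have h1 : cr (cr q e) (cr q f) = pairing q (cr e f) • q := by
    refine ext3 ?_ ?_ ?_ <;> simp [pairing] <;> ring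
  rw [h1, h]
  exact smul_ne_zero (pairing_star_ne hq) hq

lemma eq_of_cr_eq_zero {q q' : V3} (hq : q ≠ 0) (h : cr q' q = 0) : ∃ c : ℂ, c • q = q' := by
  have hp := pairing_star_ne hq
  have e0 := congrFun h 0
  have e1 := congrFun h 1
  have e2 := congrFun h 2
  simp only [cr_0, cr_1, cr_2, Pi.zero_apply] at e0 e1 e2
  refine ⟨pairing q' (star q) / pairing q (star q), ?_⟩
  refine ext3 ?_ ?_ ?_ <;> rw [Pi.smul_apply, smul_eq_mul, div_mul_eq_mul_div, div_eq_iff hp] <;>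
    simp only [pairing]
  · linear_combination (star q 2) * e1 - (star q 1) * e2
  · linear_combination (star q 0) * e2 - (star q 2) * e0
  · linear_combination (star q 1) * e0 - (star q 0) * e1

lemma delta_ne {q e f q' : V3} (h : cr e f = star q) (hc : cr q' q ≠ 0) :
    pairing q' (cr q e) * pairing f (star q') - pairing q' (cr q f) * pairing e (star q') ≠ 0 := by
  have := pairing_star_ne hc
  have h0 := congrFun h 0
  have h1 := congrFun h 1
  have h2 := congrFun h 2
  simp only [cr_0, cr_1, cr_2] at h0 h1 h2
  have key : pairing q' (cr q e) * pairing f (star q') - pairing q' (cr q f) * pairing e (star q')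
      = pairing (cr e f) (cr (cr q' q) (star q')) := by
    simp only [pairing, cr_0, cr_1, cr_2]
    ring
  rw [key, h]
  rw [star_cr] at this
  convert this using 1
  simp only [pairing, cr_0, cr_1, cr_2]
  ring

open Polynomial in
lemma split_poly {a b c d : ℂ} (h : a * d - b * c ≠ 0) (g : ℂ[X]) (D : ℕ)
    (hg : g.natDegree ≤ D + 1) : ∃ g1 g2 : ℂ[X], g1.natDegree ≤ D ∧ g2.natDegree ≤ D ∧
      g = (C a * X + C b) * g1 + (C c * X + C d) * g2 := by
  set Δ := a * d - b * c with hΔ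
  have hd : g.divX.natDegree ≤ D := by
    rw [natDegree_divX_eq_natDegree_tsub_one]; omega
  refine ⟨C Δ⁻¹ * (C d * g.divX - C (c * g.coeff 0)), C Δ⁻¹ * (C (a * g.coeff 0) - C b * g.divX),
    ?_, ?_, ?_⟩
  · refine (natDegree_C_mul_le _ _).trans ((natDegree_sub_le _ _).trans ?_)
    refine max_le ((natDegree_C_mul_le _ _).trans hd) ?_
    rw [natDegree_C]; exact Nat.zero_le _
  · refine (natDegree_C_mul_le _ _).trans ((natDegree_sub_le _ _).trans ?_)
    refine max_le ?_ ((natDegree_C_mul_le _ _).trans hd)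
    rw [natDegree_C]; exact Nat.zero_le _
  · have hC : C Δ⁻¹ * C Δ = (1 : ℂ[X]) := by rw [← C_mul, inv_mul_cancel₀ h, C_1]
    have hC2 : C Δ = C a * C d - C b * (C c : ℂ[X]) := by rw [hΔ]; simp
    have hX := g.divX_mul_X_add
    rw [hC2] at hC
    simp only [C_mul]
    linear_combination (-1 : ℂ[X]) * hX - (g.divX * X + C (g.coeff 0)) * hC

open Polynomial in
/-- Restriction of polynomials to an affine chart of a twistor fiber. -/
def lineHom (q e f : V3) : PRing →ₐ[ℂ] ℂ[X] :=
  MvPolynomial.aeval (Sum.elim (fun i => C (e i) * X + C (f i))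
    (fun i => C (cr q e i) * X + C (cr q f i)))

def linP (v : V3) : PRing := ∑ i : Fin 3, MvPolynomial.C (v i) * MvPolynomial.X (Sum.inl i)
def linL (v : V3) : PRing := ∑ i : Fin 3, MvPolynomial.C (v i) * MvPolynomial.X (Sum.inr i)

lemma linP_mem (v : V3) : linP v ∈ Abi 1 0 :=
  Submodule.sum_mem _ fun i _ =>
    (MvPolynomial.isWeightedHomogeneous_X ℂ wt (Sum.inl i)).C_mul (v i)

lemma linL_mem (v : V3) : linL v ∈ Abi 0 1 :=
  Submodule.sum_mem _ fun i _ =>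
    (MvPolynomial.isWeightedHomogeneous_X ℂ wt (Sum.inr i)).C_mul (v i)

open Polynomial in
lemma lineHom_linP (q e f v : V3) :
    lineHom q e f (linP v) = C (pairing e v) * X + C (pairing f v) := by
  simp [lineHom, linP, pairing, Fin.sum_univ_three]
  ring

open Polynomial in
lemma lineHom_linL (q e f v : V3) :
    lineHom q e f (linL v) = C (pairing v (cr q e)) * X + C (pairing v (cr q f)) := by
  simp [lineHom, linL, pairing, Fin.sum_univ_three]
  ring

lemma lineHom_flag (q e f : V3) : lineHom q e f flagPoly = 0 := by
  simp [lineHom, flagPoly, Fin.sum_univ_three]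
  ring

lemma eval_lineHom (q e f : V3) (G : PRing) (x : ℂ) :
    (lineHom q e f G).eval x = evalP G (x • e + f) (x • cr q e + cr q f) := by
  induction G using MvPolynomial.induction_on with
  | C c => simp [lineHom, evalP]
  | add p r hp hr =>
    rw [map_add, Polynomial.eval_add, hp, hr]
    simp [evalP]
  | mul_X p i hp =>
    rw [map_mul, Polynomial.eval_mul, hp]
    rcases i with i | i <;> simp only [evalP, map_mul, MvPolynomial.eval_X] <;>
      simp [lineHom] <;> left <;> ring

lemma lineHom_eq_zero {q e f : V3} (hq : q ≠ 0) (h : cr e f = star q) {G : PRing}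
    (hG : twFiber q ⊆ SZero G) : lineHom q e f G = 0 := by
  apply Polynomial.funext
  intro x
  rw [eval_lineHom, Polynomial.eval_zero]
  have h0 := congrFun h 0
  have h1 := congrFun h 1
  have h2 := congrFun h 2
  refine (hG (a := (x • e + f, x • cr q e + cr q f)) ⟨?_, ?_, ?_, ?_, ?_⟩).2.2.2
  · intro hz
    apply star_ne_zero.2 hq
    rw [← h]
    have e' : cr e f = cr e (x • e + f) := by
      refine ext3 ?_ ?_ ?_ <;> simp <;> ring
    rw [e']
    dsimp only at hz
    rw [hz]
    refine ext3 ?_ ?_ ?_ <;> simp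
  · intro hz
    apply cr_cr_ne hq h
    have e' : cr (cr q e) (cr q f) = cr (cr q e) (x • cr q e + cr q f) := by
      refine ext3 ?_ ?_ ?_ <;> simp <;> ring
    rw [e']
    dsimp only at hz
    rw [hz]
    refine ext3 ?_ ?_ ?_ <;> simp
  · simp [pairing]; ring
  · simp [pairing]; ring
  · rw [← h]; simp [pairing]; ring

lemma interp0 {q e f : V3} (hq : q ≠ 0) (h : cr e f = star q) (m n : ℕ) (g : Polynomial ℂ)
    (hg : g.natDegree ≤ m + n) : ∃ G ∈ Abi m n, lineHom q e f G = g := by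
  induction m generalizing g with
  | zero =>
    induction n generalizing g with
    | zero =>
      refine ⟨MvPolynomial.C (g.coeff 0), MvPolynomial.isWeightedHomogeneous_C wt _, ?_⟩
      rw [lineHom, MvPolynomial.aeval_C]
      exact (Polynomial.eq_C_of_natDegree_le_zero (by simpa using hg)).symm
    | succ n ih =>
      obtain ⟨v, w, hvw⟩ := exists_minor (cr_cr_ne hq h)
      obtain ⟨g1, g2, h1, h2, rfl⟩ := split_poly hvw g (0 + n) (by omega)
      obtain ⟨G1, hG1, rfl⟩ := ih g1 h1
      obtain ⟨G2, hG2, rfl⟩ := ih g2 h2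
      refine ⟨linL v * G1 + linL w * G2, ?_, ?_⟩
      · have a1 := Abi_mul (linL_mem v) hG1
        have a2 := Abi_mul (linL_mem w) hG2
        rw [add_comm 1 n] at a1 a2
        exact Submodule.add_mem _ a1 a2
      · rw [map_add, map_mul, map_mul, lineHom_linL, lineHom_linL]
        simp only [pairing, mul_comm]
  | succ m ih =>
    obtain ⟨v, w, hvw⟩ := exists_minor (h ▸ star_ne_zero.2 hq : cr e f ≠ 0)
    obtain ⟨g1, g2, h1, h2, rfl⟩ := split_poly hvw g (m + n) (by omega)
    obtain ⟨G1, hG1, rfl⟩ := ih g1 h1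
    obtain ⟨G2, hG2, rfl⟩ := ih g2 h2
    refine ⟨linP v * G1 + linP w * G2, ?_, ?_⟩
    · have a1 := Abi_mul (linP_mem v) hG1
      have a2 := Abi_mul (linP_mem w) hG2
      rw [add_comm 1 m, zero_add] at a1 a2
      exact Submodule.add_mem _ a1 a2
    · rw [map_add, map_mul, map_mul, lineHom_linP, lineHom_linP]

lemma interp {ι : Type*} [DecidableEq ι] (q e f : ι → V3) (hq : ∀ i, q i ≠ 0)
    (h : ∀ i, cr (e i) (f i) = star (q i)) (hd : ∀ i j, i ≠ j → cr (q i) (q j) ≠ 0)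
    (i : ι) (T : Finset ι) (hi : i ∉ T) (m n : ℕ) (hm : T.card ≤ m) (hn : T.card ≤ n)
    (g : Polynomial ℂ) (hg : g.natDegree ≤ m + n) :
    ∃ G ∈ Abi m n, lineHom (q i) (e i) (f i) G = g ∧
      ∀ j ∈ T, lineHom (q j) (e j) (f j) G = 0 := by
  induction T using Finset.induction_on generalizing m n g with
  | empty =>
    obtain ⟨G, hG, hg⟩ := interp0 (hq i) (h i) m n g hg
    exact ⟨G, hG, hg, by simp⟩
  | insert j T hj ih =>
    rw [Finset.card_insert_of_notMem hj] at hm hn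
    obtain ⟨m, rfl⟩ := Nat.exists_eq_add_of_le' (show 1 ≤ m by omega)
    obtain ⟨n, rfl⟩ := Nat.exists_eq_add_of_le' (show 1 ≤ n by omega)
    have hij : j ≠ i := fun hh => hi (by simp [hh])
    have hi' : i ∉ T := fun hh => hi (by simp [hh])
    obtain ⟨g1, g2, h1, h2, rfl⟩ := split_poly (delta_ne (h i) (hd j i hij)) g (m + n + 1) (by omega)
    obtain ⟨G1, hG1, rfl, hz1⟩ := ih hi' (m + 1) n (by omega) (by omega) g1 (by omega)
    obtain ⟨G2, hG2, rfl, hz2⟩ := ih hi' m (n + 1) (by omega) (by omega) g2 (by omega)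
    refine ⟨linL (q j) * G1 + linP (star (q j)) * G2, ?_, ?_, ?_⟩
    · have a1 := Abi_mul (linL_mem (q j)) hG1
      have a2 := Abi_mul (linP_mem (star (q j))) hG2
      rw [zero_add, add_comm 1 n] at a1
      rw [zero_add, add_comm 1 m] at a2
      exact Submodule.add_mem _ a1 a2
    · rw [map_add, map_mul, map_mul, lineHom_linP, lineHom_linL]
    · intro k hk
      rcases Finset.mem_insert.1 hk with rfl | hk
      · rw [map_add, map_mul, map_mul, lineHom_linP, lineHom_linL, ← h k]
        have z1 : pairing (q k) (cr (q k) (e k)) = 0 := by simp [pairing]; ring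
        have z2 : pairing (q k) (cr (q k) (f k)) = 0 := by simp [pairing]; ring
        have z3 : pairing (e k) (cr (e k) (f k)) = 0 := by simp [pairing]; ring
        have z4 : pairing (f k) (cr (e k) (f k)) = 0 := by simp [pairing]; ring
        rw [z1, z2, z3, z4]
        simp
      · rw [map_add, map_mul, map_mul, hz1 k hk, hz2 k hk]
        simp

/-- The polynomial defining `j(S)`. -/
def conjP (P : PRing) : PRing :=
  MvPolynomial.rename Sum.swap (MvPolynomial.map (starRingEnd ℂ) P)

lemma conjP_mem {a b : ℕ} {P : PRing} (hP : MvPolynomial.IsWeightedHomogeneous wt P (a, b)) :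
    conjP P ∈ Abi b a := by
  induction hP using MvPolynomial.IsWeightedHomogeneous.induction_on with
  | zero => simp [conjP]
  | add p q hp hq h1 h2 =>
    have : conjP (p + q) = conjP p + conjP q := by simp [conjP]
    rw [this]
    exact Submodule.add_mem _ h1 h2
  | monomial d r hr =>
    unfold conjP
    rw [MvPolynomial.map_monomial, MvPolynomial.rename_monomial]
    apply MvPolynomial.isWeightedHomogeneous_monomial
    rw [weight_wt, Prod.mk.injEq] at hr
    rw [weight_wt]
    have hs : ∀ i, Finsupp.mapDomain Sum.swap d (Sum.swap i) = d i := fun i =>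
      Finsupp.mapDomain_apply (Equiv.sumComm (Fin 3) (Fin 3)).injective d i
    have h1 : ∀ i, Finsupp.mapDomain Sum.swap d (Sum.inl i) = d (Sum.inr i) := fun i => hs (Sum.inr i)
    have h2 : ∀ i, Finsupp.mapDomain Sum.swap d (Sum.inr i) = d (Sum.inl i) := fun i => hs (Sum.inl i)
    simp only [h1, h2, hr.1, hr.2]

lemma evalP_conjP (P : PRing) (p l : V3) :
    evalP (conjP P) p l = star (evalP P (star l) (star p)) := by
  unfold evalP conjP
  rw [MvPolynomial.eval_rename]
  induction P using MvPolynomial.induction_on with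
  | C c => simp
  | add r s hr hs => simp only [map_add, star_add, hr, hs]
  | mul_X r i hr =>
    simp only [map_mul, star_mul', hr]
    rcases i with i | i <;> simp

lemma mem_SZero_conjP (P : PRing) (x : V3 × V3) : x ∈ SZero (conjP P) ↔ jmap x ∈ SZero P := by
  obtain ⟨p, l⟩ := x
  have : pairing (star l) (star p) = star (pairing p l) := by simp [pairing]; ring
  simp only [SZero, jmap, Set.mem_ofPred_eq, evalP_conjP, this, star_eq_zero, ne_eq]
  tauto

lemma jmap_jmap (x : V3 × V3) : jmap (jmap x) = x := by simp [jmap]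

lemma image_jmap (P : PRing) : jmap '' SZero P = SZero (conjP P) := by
  ext x
  rw [mem_SZero_conjP]
  constructor
  · rintro ⟨y, hy, rfl⟩
    rwa [jmap_jmap]
  · intro h
    exact ⟨_, h, jmap_jmap x⟩

lemma jmap_twFiber {q : V3} {x : V3 × V3} (hx : x ∈ twFiber q) : jmap x ∈ twFiber q := by
  obtain ⟨p, l⟩ := x
  obtain ⟨h1, h2, h3, h4, h5⟩ := hx
  dsimp only at *
  refine ⟨star_ne_zero.2 h2, star_ne_zero.2 h1, ?_, ?_, ?_⟩
  · have : pairing (star l) (star p) = star (pairing p l) := by simp [pairing]; ring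
    simp [jmap, this, h3]
  · have : pairing q (star p) = star (pairing p (star q)) := by simp [pairing]; ring
    simp [jmap, this, h5]
  · have : pairing (star l) (star q) = star (pairing q l) := by simp [pairing]; ring
    simp [jmap, this, h4]

lemma not_dvd {P : PRing} (hne : SZero P ≠ jmap '' SZero P) : ¬ mkR P ∣ mkR (conjP P) := by
  rintro ⟨w, hw⟩
  obtain ⟨w, rfl⟩ := Ideal.Quotient.mk_surjective w
  have hz : mkR (conjP P - P * w) = 0 := by rw [map_sub, map_mul, hw]; simp
  obtain ⟨z, hz⟩ := mkR_eq_zero.1 hz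
  have hsub : SZero P ⊆ SZero (conjP P) := by
    rintro ⟨p, l⟩ ⟨h1, h2, h3, h4⟩
    refine ⟨h1, h2, h3, ?_⟩
    dsimp only at *
    have hf : MvPolynomial.eval (Sum.elim p l) flagPoly = 0 := by
      rw [← h3]; simp [flagPoly, pairing, Fin.sum_univ_three]
    have := congrArg (MvPolynomial.eval (Sum.elim p l)) hz
    rw [map_sub, map_mul, map_mul, hf] at this
    unfold evalP at h4 ⊢
    rw [h4] at this
    simpa using this
  apply hne
  rw [image_jmap]
  refine Set.Subset.antisymm hsub fun x hx => ?_
  have := hsub ((mem_SZero_conjP P x).1 hx)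
  rw [mem_SZero_conjP, jmap_jmap] at this
  exact this

lemma bound {ι : Type*} [Fintype ι] {a b : ℕ} (ha : 1 ≤ a) (hb : 1 ≤ b) {P : PRing}
    (hhom : MvPolynomial.IsWeightedHomogeneous wt P (a, b))
    (hprime : Prime (mkR P)) (hne : SZero P ≠ jmap '' SZero P)
    (q : ι → V3) (hq : ∀ i, q i ≠ 0) (hd : ∀ i j, i ≠ j → cr (q i) (q j) ≠ 0)
    (hS : ∀ i, twFiber (q i) ⊆ SZero P) (hc : Fintype.card ι = a ^ 2 + a * b + b ^ 2) : False := by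
  classical
  have hE : ∀ i, ∃ e f, cr e f = star (q i) := fun i => exists_cr (star_ne_zero.2 (hq i))
  choose e f hef using hE
  have hS' : ∀ i, twFiber (q i) ⊆ SZero (conjP P) := fun i x hx =>
    (mem_SZero_conjP P x).2 (hS i (jmap_twFiber hx))
  set K := Fintype.card ι with hK
  have hK1 : 1 ≤ K := by rw [hc]; nlinarith
  obtain ⟨I, hI, hIv, hIf⟩ := finrank_ideal hK1 hhom (conjP_mem hhom) hprime (not_dvd hne)
  set k := a + b + K with hk
  let φ : ι → (RR →ₐ[ℂ] Polynomial ℂ) := fun i =>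
    Ideal.Quotient.liftₐ _ (lineHom (q i) (e i) (f i)) (by
      intro x hx
      obtain ⟨y, rfl⟩ := Ideal.mem_span_singleton.1 hx
      rw [map_mul, lineHom_flag, zero_mul])
  have hφ : ∀ i G, φ i (mkR G) = lineHom (q i) (e i) (f i) G := fun i G => rfl
  let ρ : RR →ₗ[ℂ] (ι → Polynomial ℂ) := LinearMap.pi fun i => (φ i).toLinearMap
  have hker : I ≤ Rbi k k ⊓ LinearMap.ker ρ := by
    refine le_inf hI ?_
    intro x hx
    obtain ⟨u, v, rfl⟩ := hIv x hx
    rw [LinearMap.mem_ker]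
    funext i
    change φ i _ = 0
    rw [map_add, map_mul, map_mul, hφ, hφ, lineHom_eq_zero (hq i) (hef i) (hS i),
      lineHom_eq_zero (hq i) (hef i) (hS' i)]
    simp
  let J : (ι → Polynomial.degreeLT ℂ (k + k + 1)) →ₗ[ℂ] (ι → Polynomial ℂ) :=
    LinearMap.pi fun i => (Polynomial.degreeLT ℂ (k + k + 1)).subtype ∘ₗ LinearMap.proj i
  have hJ : Function.Injective J := by
    intro x y hxy
    funext i
    exact Subtype.ext (congrFun hxy i)
  have hJr : LinearMap.range J ≤ (Rbi k k).map ρ := by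
    rintro _ ⟨g, rfl⟩
    have hG : ∀ i, ∃ G ∈ Abi k k, lineHom (q i) (e i) (f i) G = (g i : Polynomial ℂ) ∧
        ∀ j ∈ Finset.univ.erase i, lineHom (q j) (e j) (f j) G = 0 := by
      intro i
      have hcard : (Finset.univ.erase i).card ≤ k := by
        have := Finset.card_le_univ (Finset.univ.erase i)
        omega
      refine interp q e f hq hef hd i _ (by simp) k k hcard hcard _ ?_
      have := (g i).2
      rw [Polynomial.mem_degreeLT] at this
      exact Polynomial.natDegree_le_iff_coeff_eq_zero.2 fun N hN =>
        (Polynomial.degree_lt_iff_coeff_zero _ _).1 this N (by omega)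
    choose G hGm hGi hGj using hG
    refine ⟨mkR (∑ i, G i), mem_Rbi.2 ⟨_, Submodule.sum_mem _ fun i _ => hGm i, rfl⟩, ?_⟩
    funext j
    change φ j (mkR (∑ i, G i)) = (g j : Polynomial ℂ)
    rw [hφ, map_sum, Finset.sum_eq_single j, hGi]
    · intro i _ hij
      exact hGj i j (by simp [Ne.symm hij])
    · simp
  have h1 := finrank_map_ker ρ (Rbi k k)
  have : FiniteDimensional ℂ (Rbi k k ⊓ LinearMap.ker ρ : Submodule ℂ RR) :=
    Submodule.finiteDimensional_inf_left _ _
  have h2 := Submodule.finrank_mono hker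
  have h3 := Submodule.finrank_mono hJr
  rw [LinearMap.finrank_range_of_inj hJ, Module.finrank_pi_fintype] at h3
  have hdeg : Module.finrank ℂ (Polynomial.degreeLT ℂ (k + k + 1)) = k + k + 1 := by
    rw [(Polynomial.degreeLTEquiv ℂ _).finrank_eq]; simp
  simp only [hdeg, Finset.sum_const, Finset.card_univ, smul_eq_mul] at h3
  rw [← hK] at h3
  have h4 : K * (k + k + 1) + Module.finrank ℂ (Rbi (b + K) (a + K)) +
      Module.finrank ℂ (Rbi (a + K) (b + K)) ≤
      Module.finrank ℂ (Rbi k k) + Module.finrank ℂ (Rbi K K) := by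
    omega
  have h5 : ((K * (k + k + 1) + Module.finrank ℂ (Rbi (b + K) (a + K)) +
      Module.finrank ℂ (Rbi (a + K) (b + K)) : ℕ) : ℚ) ≤
      ((Module.finrank ℂ (Rbi k k) + Module.finrank ℂ (Rbi K K) : ℕ) : ℚ) := by
    exact_mod_cast h4
  push_cast at h5
  rw [finrank_Rbi _ _ (by omega) (by omega), finrank_Rbi _ _ (by omega) (by omega),
    finrank_Rbi _ _ (by omega) (by omega), finrank_Rbi _ _ (by omega) (by omega)] at h5
  have hkq : (k : ℚ) = a + b + K := by rw [hk]; push_cast; ring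
  have hcq : (K : ℚ) = a ^ 2 + a * b + b ^ 2 := by rw [hc]; push_cast; ring
  have haq : (1 : ℚ) ≤ a := by exact_mod_cast ha
  have hbq : (1 : ℚ) ≤ b := by exact_mod_cast hb
  have hK1q : (1 : ℚ) ≤ K := by exact_mod_cast hK1
  push_cast at h5
  rw [hkq] at h5
  have h6 : (K : ℚ) * (2 * (a + b + K) + 1) ≤
      (a ^ 2 + a * b + b ^ 2) * (2 * K + 2 + a + b) := by
    linear_combination h5
  rw [← hcq] at h6
  have h7 := le_of_mul_le_mul_left h6 (by linarith)
  linarith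

theorem stmt_15 (a b : ℕ) (ha : 1 ≤ a) (hb : 1 ≤ b) (P : PRing)
    (hhom : MvPolynomial.IsWeightedHomogeneous wt P (a, b))
    (hprime : Prime (Ideal.Quotient.mk (Ideal.span {flagPoly}) P))
    (hne : SZero P ≠ jmap '' SZero P) :
    {x : Projectivization ℂ V3 | ∃ (q : V3) (hq : q ≠ 0),
        x = Projectivization.mk ℂ q hq ∧ twFiber q ⊆ SZero P}.encard ≤
      ((a ^ 2 + a * b + b ^ 2 - 1 : ℕ) : ℕ∞) := by
  by_contra hcon
  rw [not_le] at hcon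
  have hpos : 1 ≤ a ^ 2 + a * b + b ^ 2 := by nlinarith
  have hle : ((a ^ 2 + a * b + b ^ 2 : ℕ) : ℕ∞) ≤ {x : Projectivization ℂ V3 | ∃ (q : V3) (hq : q ≠ 0),
        x = Projectivization.mk ℂ q hq ∧ twFiber q ⊆ SZero P}.encard := by
    have := Order.add_one_le_of_lt hcon
    refine le_trans ?_ this
    have e : a ^ 2 + a * b + b ^ 2 = (a ^ 2 + a * b + b ^ 2 - 1) + 1 := by omega
    conv_lhs => rw [e]
    push_cast
    exact le_rfl
  obtain ⟨t, ht, htc⟩ := Set.exists_subset_encard_eq hle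
  have htf : t.Finite := Set.finite_of_encard_eq_coe htc
  have := htf.fintype
  have hcard : Fintype.card t = a ^ 2 + a * b + b ^ 2 := by
    rw [Set.encard_eq_coe_toFinset_card] at htc
    rw [← Set.toFinset_card]
    exact_mod_cast htc
  have hx : ∀ x : t, ∃ (q : V3) (hq : q ≠ 0), (x : Projectivization ℂ V3) =
      Projectivization.mk ℂ q hq ∧ twFiber q ⊆ SZero P := fun x => ht x.2
  choose q hq hxq hS using hx
  refine bound ha hb hhom hprime hne q hq ?_ hS hcard
  intro i j hij h0
  apply hij
  apply Subtype.ext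
  rw [hxq i, hxq j]
  exact (Projectivization.mk_eq_mk_iff' ℂ _ _ (hq i) (hq j)).2 (eq_of_cr_eq_zero (hq j) h0)
end
end
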